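/- arXiv:2310.14896 — 4 statements merged into one kernel-verified Lean document; each statement's English description precedes it below -/
import Mathlib

section
/- Let ε > 0, let n ≥ 1 be an integer, and let f ∈ 𝓔_ε. Set u := √(f'). Then there exist, for n ≥ 2, functions j_2, …, j_n ∈ 𝓔_ε with ũ_k := √(j_k'), functions h_2, …, h_n : ℝ² → ℝ, a function R_n : ℝ² → ℝ, and positive constants C_{f,2}, …, C_{f,n} such that for all x, y ∈ ℝ: f(x) − f(y) = (x − y) u(x) u(y) + Σ_{k=2}^n (x − y)^k h_k(x, y) + R_n(x, y) (x − y)^{n+1}, where the sum Σ_{k=2}^n is dropped for n = 1, and where |h_k(x, y)| ≤ C_{f,k} ũ_k(x) ũ_k(y) for all 2 ≤ k ≤ n and all x, y ∈ ℝ, and |R_n(x, y)| ≤ C_{f,n} for all x, y ∈ ℝ. -/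
open scoped BigOperators

/-- The function class `𝓔_ε`: smooth nonnegative nondecreasing functions with a smooth
square root of the derivative, vanishing on `(-∞, ε/2)` and equal to `1` on `(ε, ∞)`. -/
def InClassE (ε : ℝ) (f : ℝ → ℝ) : Prop :=
  ContDiff ℝ (⊤ : ℕ∞) f ∧ (∀ x, 0 ≤ f x) ∧ (∀ x, 0 ≤ deriv f x) ∧
    ContDiff ℝ (⊤ : ℕ∞) (fun x => Real.sqrt (deriv f x)) ∧
    (∀ x, x < ε / 2 → f x = 0) ∧ (∀ x, ε < x → f x = 1)


/-- Smooth functions vanishing outside `[a, b]`. -/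
def SmoothSupp (a b : ℝ) (g : ℝ → ℝ) : Prop :=
  ContDiff ℝ (⊤ : ℕ∞) g ∧ (∀ x, x < a → g x = 0) ∧ (∀ x, b < x → g x = 0)

lemma deriv_zero_left {g : ℝ → ℝ} {a c : ℝ} (h : ∀ x, x < a → g x = c) :
    ∀ x, x < a → deriv g x = 0 := by
  intro x hx
  have : g =ᶠ[nhds x] fun _ => c := by
    filter_upwards [Iio_mem_nhds hx] with y hy using h y hy
  rw [this.deriv_eq]; simp

lemma deriv_zero_right {g : ℝ → ℝ} {a c : ℝ} (h : ∀ x, a < x → g x = c) :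
    ∀ x, a < x → deriv g x = 0 := by
  intro x hx
  have : g =ᶠ[nhds x] fun _ => c := by
    filter_upwards [Ioi_mem_nhds hx] with y hy using h y hy
  rw [this.deriv_eq]; simp

lemma zero_left_closed {g : ℝ → ℝ} {a : ℝ} (hg : Continuous g) (h : ∀ x, x < a → g x = 0) :
    ∀ x, x ≤ a → g x = 0 := by
  have hc : IsClosed {x | g x = 0} := isClosed_eq hg continuous_const
  have : closure (Set.Iio a) ⊆ {x | g x = 0} := closure_minimal (fun x hx => h x hx) hc
  rw [closure_Iio] at this
  exact fun x hx => this hx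

lemma smooth_deriv {g : ℝ → ℝ} (hg : ContDiff ℝ (⊤ : ℕ∞) g) : ContDiff ℝ (⊤ : ℕ∞) (deriv g) :=
  (contDiff_infty_iff_deriv.1 hg).2

lemma smooth_diff {g : ℝ → ℝ} (hg : ContDiff ℝ (⊤ : ℕ∞) g) : Differentiable ℝ g :=
  (contDiff_infty_iff_deriv.1 hg).1

lemma SmoothSupp.deriv {a b : ℝ} {g : ℝ → ℝ} (h : SmoothSupp a b g) :
    SmoothSupp a b (deriv g) :=
  ⟨smooth_deriv h.1, deriv_zero_left h.2.1, deriv_zero_right h.2.2⟩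

lemma SmoothSupp.iter {a b : ℝ} (m : ℕ) : ∀ {g : ℝ → ℝ}, SmoothSupp a b g →
    SmoothSupp a b (iteratedDeriv m g) := by
  induction m with
  | zero => intro g h; simpa using h
  | succ m ih => intro g h; rw [iteratedDeriv_succ']; exact ih h.deriv

lemma SmoothSupp.bdd {a b : ℝ} {g : ℝ → ℝ} (h : SmoothSupp a b g) :
    ∃ B, 0 ≤ B ∧ ∀ x, |g x| ≤ B := by
  have hc : HasCompactSupport g := by
    apply HasCompactSupport.intro (isCompact_Icc (a := a) (b := b))
    intro x hx
    by_cases h1 : x < a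
    · exact h.2.1 x h1
    · apply h.2.2 x
      by_contra h2
      exact hx ⟨not_lt.1 h1, not_lt.1 h2⟩
  obtain ⟨C, hC⟩ := hc.exists_bound_of_continuous h.1.continuous
  exact ⟨C, (norm_nonneg _).trans (hC 0), hC⟩

/-- Taylor expansion with globally bounded remainder. -/
lemma taylor_bdd {a b : ℝ} (N : ℕ) : ∀ {g : ℝ → ℝ}, SmoothSupp a b g →
    ∃ C, 0 ≤ C ∧ ∀ x t, |g t - ∑ i ∈ Finset.range N,
      iteratedDeriv i g x * ((t - x) ^ i / (i.factorial : ℝ))| ≤ C * |t - x| ^ N := by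
  induction N with
  | zero => intro g h; simpa using h.bdd
  | succ N ih =>
    intro g h
    obtain ⟨C, hC0, hC⟩ := ih h.deriv
    refine ⟨C, hC0, fun x t => ?_⟩
    set φ : ℝ → ℝ := fun s => g s - ∑ i ∈ Finset.range (N + 1),
      iteratedDeriv i g x * ((s - x) ^ i / (i.factorial : ℝ)) with hφ
    have hd : ∀ s, HasDerivAt φ (deriv g s - ∑ i ∈ Finset.range N,
      iteratedDeriv i (deriv g) x * ((s - x) ^ i / (i.factorial : ℝ))) s := by
      intro s
      refine (smooth_diff h.1 s).hasDerivAt.sub ?_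
      have : ∀ i ∈ Finset.range (N + 1), HasDerivAt
          (fun s => iteratedDeriv i g x * ((s - x) ^ i / (i.factorial : ℝ)))
          (iteratedDeriv i g x * ((i : ℝ) * (s - x) ^ (i - 1) * 1 / (i.factorial : ℝ))) s := by
        intro i _
        exact ((((hasDerivAt_id s).sub_const x).pow i).div_const _).const_mul _
      have h2 := HasDerivAt.fun_sum this
      convert h2 using 1
      rw [Finset.sum_range_succ']
      simp only [Nat.cast_zero, zero_mul, zero_div, mul_zero, add_zero]
      refine Finset.sum_congr rfl fun i _ => ?_
      rw [iteratedDeriv_succ', Nat.factorial_succ]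
      have : (i.factorial : ℝ) ≠ 0 := by positivity
      have : ((i : ℝ) + 1) ≠ 0 := by positivity
      push_cast
      field_simp
      try simp
    have hx : φ x = 0 := by
      simp only [hφ]
      rw [Finset.sum_range_succ']
      simp
    have key := Convex.norm_image_sub_le_of_norm_deriv_le (f := φ) (s := Set.uIcc x t)
      (x := x) (y := t) (C := C * |t - x| ^ N) (fun s _ => (hd s).differentiableAt)
      (by
        intro s hs
        rw [(hd s).deriv]
        refine (hC x s).trans ?_
        exact mul_le_mul_of_nonneg_left
          (pow_le_pow_left₀ (abs_nonneg _) (Set.abs_sub_left_of_mem_uIcc hs) _) hC0) (convex_uIcc _ _) (by simp) (by simp)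
    rw [hx, sub_zero, Real.norm_eq_abs, Real.norm_eq_abs] at key
    rw [pow_succ, ← mul_assoc]
    exact key

/-- Flatness. -/
lemma flat_bound (m : ℕ) : ∀ {g : ℝ → ℝ}, ContDiff ℝ (⊤ : ℕ∞) g → (∀ x, x < 0 → g x = 0) →
    ∃ C, 0 ≤ C ∧ ∀ t ∈ Set.Icc (0 : ℝ) 2, |g t| ≤ C * t ^ m := by
  induction m with
  | zero =>
    intro g h _
    obtain ⟨C, hC⟩ := (isCompact_Icc (a := (0 : ℝ)) (b := 2)).exists_bound_of_continuousOn
      h.continuous.continuousOn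
    exact ⟨C, (norm_nonneg _).trans (hC 0 (by simp)), by simpa using hC⟩
  | succ m ih =>
    intro g h h0
    obtain ⟨C, hC0, hC⟩ := ih (smooth_deriv h) (deriv_zero_left h0)
    refine ⟨C, hC0, fun t ht => ?_⟩
    have key := Convex.norm_image_sub_le_of_norm_deriv_le (f := g) (s := Set.Icc 0 t)
      (x := 0) (y := t) (C := C * t ^ m) (fun s _ => smooth_diff h s)
      (by
        intro s hs
        refine (hC s ⟨hs.1, hs.2.trans ht.2⟩).trans ?_
        have := hs.1
        gcongr
        exact hs.2) (convex_Icc _ _) (by simp [ht.1]) (by simp [ht.1])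
    rw [zero_left_closed h.continuous h0 0 le_rfl, sub_zero, sub_zero, Real.norm_eq_abs,
      Real.norm_eq_abs, abs_of_nonneg ht.1] at key
    rw [pow_succ, ← mul_assoc]
    exact key

lemma smoothTransition_bdd (m : ℕ) :
    ∃ M, 0 ≤ M ∧ ∀ t, |iteratedDeriv m Real.smoothTransition t| ≤ M := by
  cases m with
  | zero =>
    refine ⟨1, zero_le_one, fun t => ?_⟩
    rw [iteratedDeriv_zero, abs_of_nonneg (Real.smoothTransition.nonneg t)]
    exact Real.smoothTransition.le_one t
  | succ m =>
    rw [iteratedDeriv_succ']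
    have : SmoothSupp 0 1 (deriv Real.smoothTransition) :=
      ⟨smooth_deriv Real.smoothTransition.contDiff,
        deriv_zero_left fun x hx => Real.smoothTransition.zero_of_nonpos hx.le,
        deriv_zero_right fun x hx => Real.smoothTransition.one_of_one_le hx.le⟩
    exact (this.iter m).bdd

/-- Smooth flat majorant. -/
lemma majorant {g : ℝ → ℝ} (hg : ContDiff ℝ (⊤ : ℕ∞) g) (h0 : ∀ x, x < 0 → g x = 0)
    {B : ℝ} (hB : ∀ x, |g x| ≤ B) :
    ∃ w : ℝ → ℝ, ContDiff ℝ (⊤ : ℕ∞) w ∧ (∀ t, t ≤ 0 → w t = 0) ∧ (∀ t, 0 ≤ w t) ∧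
      ∀ t, |g t| ≤ w t ^ 2 := by
  have hB0 : 0 ≤ B := (abs_nonneg _).trans (hB 0)
  have hex : ∀ k : ℕ, ∃ s ∈ Set.Icc (0 : ℝ) (2 * (1 / 2) ^ k),
      ∀ t ∈ Set.Icc (0 : ℝ) (2 * (1 / 2) ^ k), |g t| ≤ |g s| := by
    intro k
    obtain ⟨s, hs, hm⟩ := (isCompact_Icc (a := (0 : ℝ)) (b := 2 * (1 / 2) ^ k)).exists_isMaxOn
      ⟨0, by simp⟩ (f := fun t => |g t|) hg.continuous.abs.continuousOn
    exact ⟨s, hs, fun t ht => hm ht⟩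
  choose s hs hm using hex
  set c : ℕ → ℝ := fun k => √|g (s k)| with hc
  have hc0 : ∀ k, 0 ≤ c k := fun k => Real.sqrt_nonneg _
  have hcm : ∀ m : ℕ, ∃ A, 0 ≤ A ∧ ∀ k, c k ≤ A * ((1 / 2) ^ k) ^ m := by
    intro m
    obtain ⟨C, hC0, hC⟩ := flat_bound (2 * m) hg h0
    refine ⟨√C * 2 ^ m, by positivity, fun k => ?_⟩
    apply Real.sqrt_le_iff.2 ⟨by positivity, ?_⟩
    have h1 : ((1 : ℝ) / 2) ^ k ≤ 1 := pow_le_one₀ (by norm_num) (by norm_num)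
    refine (hC (s k) ⟨(hs k).1, (hs k).2.trans (by linarith)⟩).trans ?_
    calc C * s k ^ (2 * m) ≤ C * (2 * (1 / 2) ^ k) ^ (2 * m) := by
          have := (hs k).1
          gcongr
          exact (hs k).2
      _ = _ := by
          rw [mul_pow, mul_pow, mul_pow, Real.sq_sqrt hC0]
          ring
  have hsum : ∀ t, Summable fun k => c k * Real.smoothTransition (2 ^ k * t) := by
    intro t
    obtain ⟨A, hA0, hA⟩ := hcm 1
    refine Summable.of_nonneg_of_le (fun k => mul_nonneg (hc0 k) (Real.smoothTransition.nonneg _))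
      (fun k => ?_) ((summable_geometric_of_lt_one (r := (1 / 2 : ℝ)) (by norm_num)
        (by norm_num)).mul_left A)
    have := hA k
    rw [pow_one] at this
    exact (mul_le_of_le_one_right (hc0 k) (Real.smoothTransition.le_one _)).trans this
  have hnn : ∀ t, 0 ≤ ∑' k, c k * Real.smoothTransition (2 ^ k * t) := fun t =>
    tsum_nonneg fun k => mul_nonneg (hc0 k) (Real.smoothTransition.nonneg _)
  have hsmooth : ContDiff ℝ (⊤ : ℕ∞) fun t => ∑' k, c k * Real.smoothTransition (2 ^ k * t) := by
    choose M hM0 hM using smoothTransition_bdd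
    choose A hA0 hA using hcm
    refine contDiff_tsum (v := fun m k => A (m + 1) * M m * (1 / 2) ^ k) ?_ ?_ ?_
    · intro k
      exact contDiff_const.mul (Real.smoothTransition.contDiff.comp (contDiff_const.mul contDiff_id))
    · intro m _
      exact (summable_geometric_of_lt_one (r := (1 / 2 : ℝ)) (by norm_num)
        (by norm_num)).mul_left _
    · intro m k t _
      rw [norm_iteratedFDeriv_eq_norm_iteratedDeriv, iteratedDeriv_const_mul_field,
        iteratedDeriv_comp_const_mul (Real.smoothTransition.contDiff (n := (m : ℕ∞))) (2 ^ k),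
        Real.norm_eq_abs, abs_mul, abs_mul, abs_of_nonneg (hc0 k),
        abs_of_nonneg (by positivity : (0 : ℝ) ≤ (2 ^ k) ^ m)]
      calc c k * ((2 ^ k) ^ m * |iteratedDeriv m Real.smoothTransition (2 ^ k * t)|)
          ≤ (A (m + 1) * ((1 / 2) ^ k) ^ (m + 1)) * ((2 ^ k) ^ m * M m) := by
            have := hA0 (m + 1)
            gcongr
            · exact hA _ _
            · exact hM _ _
        _ = A (m + 1) * M m * (1 / 2) ^ k * ((1 / 2) ^ k * 2 ^ k) ^ m := by
            rw [mul_pow ((1 / 2 : ℝ) ^ k)]; ring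
        _ = _ := by
            rw [← mul_pow]; norm_num
  refine ⟨fun t => (∑' k, c k * Real.smoothTransition (2 ^ k * t)) + √B * Real.smoothTransition t,
    hsmooth.add (contDiff_const.mul Real.smoothTransition.contDiff), ?_, ?_, ?_⟩
  · intro t ht
    have : ∀ k : ℕ, Real.smoothTransition (2 ^ k * t) = 0 := fun k =>
      Real.smoothTransition.zero_of_nonpos (mul_nonpos_of_nonneg_of_nonpos (by positivity) ht)
    simp [this, Real.smoothTransition.zero_of_nonpos ht]
  · intro t
    have := Real.smoothTransition.nonneg t
    have := hnn t
    positivity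
  · intro t
    have h2 := mul_nonneg (Real.sqrt_nonneg B) (Real.smoothTransition.nonneg t)
    rcases le_or_gt t 0 with ht | ht
    · rw [zero_left_closed hg.continuous h0 t ht, abs_zero]; positivity
    rcases le_or_gt 1 t with h1 | h1
    · calc |g t| ≤ B := hB t
        _ = (√B * Real.smoothTransition t) ^ 2 := by
          rw [Real.smoothTransition.one_of_one_le h1, mul_one, Real.sq_sqrt hB0]
        _ ≤ _ := by
          gcongr
          exact le_add_of_nonneg_left (hnn t)
    · obtain ⟨k, hk1, hk2⟩ := exists_nat_pow_near (x := 1 / t) (y := 2)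
        (by rw [le_div_iff₀ ht]; linarith) (by norm_num)
      rw [le_div_iff₀ ht] at hk1
      rw [div_lt_iff₀ ht] at hk2
      have hp : ((1 : ℝ) / 2) ^ k * 2 ^ k = 1 := by rw [← mul_pow]; norm_num
      have hq : (0 : ℝ) < (1 / 2) ^ k := by positivity
      have hle : t ≤ 2 * (1 / 2) ^ (k + 1) := by
        rw [pow_succ]
        have := mul_le_mul_of_nonneg_left hk1 hq.le
        rw [← mul_assoc, hp] at this
        linarith
      have h3 := hm (k + 1) t ⟨ht.le, hle⟩
      have h4 := (hsum t).le_tsum (k + 1)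
        (fun i _ => mul_nonneg (hc0 i) (Real.smoothTransition.nonneg _))
      rw [Real.smoothTransition.one_of_one_le hk2.le, mul_one] at h4
      calc |g t| ≤ |g (s (k + 1))| := h3
        _ = c (k + 1) ^ 2 := (Real.sq_sqrt (abs_nonneg _)).symm
        _ ≤ _ := by
          have := hc0 (k + 1)
          gcongr
          linarith

lemma majorant_one {a b : ℝ} {g : ℝ → ℝ} (h : SmoothSupp a b g) :
    ∃ W, SmoothSupp a b W ∧ (∀ x, 0 ≤ W x) ∧ ∀ x, |g x| ≤ W x := by
  obtain ⟨B, _, hB⟩ := h.bdd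
  obtain ⟨wL, hL1, hL2, hL3, hL4⟩ := majorant (g := fun t => g (t + a))
    (h.1.comp (contDiff_id.add contDiff_const)) (fun x hx => h.2.1 _ (by linarith))
    (fun x => hB _)
  obtain ⟨wR, hR1, hR2, hR3, hR4⟩ := majorant (g := fun t => g (b - t))
    (h.1.comp (contDiff_const.sub contDiff_id)) (fun x hx => h.2.2 _ (by linarith))
    (fun x => hB _)
  refine ⟨fun x => wL (x - a) * wR (b - x), ⟨?_, ?_, ?_⟩, ?_, ?_⟩
  · exact (hL1.comp (contDiff_id.sub contDiff_const)).mul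
      (hR1.comp (contDiff_const.sub contDiff_id))
  · intro x hx
    simp only [hL2 (x - a) (by linarith), zero_mul]
  · intro x hx
    simp only [hR2 (b - x) (by linarith), mul_zero]
  · intro x
    exact mul_nonneg (hL3 _) (hR3 _)
  · intro x
    have h1 := hL4 (x - a)
    have h2 := hR4 (b - x)
    simp only [sub_add_cancel, sub_sub_cancel] at h1 h2
    refine abs_le_of_sq_le_sq' ?_ (mul_nonneg (hL3 _) (hR3 _)) |> abs_le.2
    rw [mul_pow, ← sq_abs, sq]
    exact mul_le_mul h1 h2 (abs_nonneg _) (sq_nonneg _)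

lemma majorant_all {a b : ℝ} {u : ℝ → ℝ} (h : SmoothSupp a b u) (N : ℕ) :
    ∃ W, SmoothSupp a b W ∧ (∀ x, 0 ≤ W x) ∧
      ∀ i < N, ∀ x, |iteratedDeriv i u x| ≤ W x := by
  induction N with
  | zero => exact ⟨fun _ => 0, ⟨contDiff_const, by simp, by simp⟩, by simp, by simp⟩
  | succ N ih =>
    obtain ⟨W, hW1, hW2, hW3⟩ := ih
    obtain ⟨V, hV1, hV2, hV3⟩ := majorant_one (h.iter N)
    refine ⟨fun x => W x + V x, ⟨hW1.1.add hV1.1, ?_, ?_⟩, ?_, ?_⟩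
    · intro x hx
      simp [hW1.2.1 x hx, hV1.2.1 x hx]
    · intro x hx
      simp [hW1.2.2 x hx, hV1.2.2 x hx]
    · intro x
      exact add_nonneg (hW2 x) (hV2 x)
    · intro i hi x
      rcases Nat.lt_succ_iff_lt_or_eq.1 hi with hi | rfl
      · exact (hW3 i hi x).trans (le_add_of_nonneg_right (hV2 x))
      · exact (hV3 x).trans (le_add_of_nonneg_left (hW2 x))

/-- Taylor polynomial with the zeroth-order term removed. -/
lemma taylor_tail {a b : ℝ} {u W : ℝ → ℝ} (h : SmoothSupp a b u) (m : ℕ)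
    (hW0 : ∀ x, 0 ≤ W x) (hW : ∀ i < m + 1, ∀ x, |iteratedDeriv i u x| ≤ W x) :
    ∃ C, 0 ≤ C ∧ ∀ x t D : ℝ, |t - x| ≤ D → D ≤ 1 → ∃ p r : ℝ,
      u t = u x + p + r ∧ |p| ≤ m * D * W x ∧ |r| ≤ C * D ^ (m + 1) := by
  obtain ⟨C, hC0, hC⟩ := taylor_bdd (m + 1) h
  refine ⟨C, hC0, fun x t D hD hD1 => ?_⟩
  have hDn : 0 ≤ D := (abs_nonneg _).trans hD
  have hCx := hC x t
  rw [Finset.sum_range_succ'] at hCx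
  simp only [iteratedDeriv_zero, pow_zero, Nat.factorial_zero, Nat.cast_one, div_one,
    mul_one] at hCx
  refine ⟨∑ k ∈ Finset.range m,
      iteratedDeriv (k + 1) u x * ((t - x) ^ (k + 1) / ((k + 1).factorial : ℝ)),
    _, (add_sub_cancel _ _).symm, ?_, (le_of_eq ?_).trans (hCx.trans ?_)⟩
  · refine (Finset.abs_sum_le_sum_abs _ _).trans ?_
    calc _ ≤ ∑ k ∈ Finset.range m, D * W x := by
          refine Finset.sum_le_sum fun k hk => ?_
          rw [abs_mul, abs_div, abs_pow, mul_comm D]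
          refine mul_le_mul (hW _ (by simpa using hk) x) ?_ (by positivity) (hW0 x)
          rw [Nat.abs_cast]
          have hf : (1 : ℝ) ≤ ((k + 1).factorial : ℝ) := by
            exact_mod_cast Nat.succ_le_of_lt (Nat.factorial_pos _)
          refine (div_le_self (by positivity) hf).trans ?_
          calc |t - x| ^ (k + 1) ≤ D ^ (k + 1) := pow_le_pow_left₀ (abs_nonneg _) hD _
            _ ≤ D := by
              rw [pow_succ]
              exact mul_le_of_le_one_left hDn (pow_le_one₀ hDn hD1)
      _ = _ := by simp [mul_assoc]
  · rw [add_comm (u x)]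
  · exact mul_le_mul_of_nonneg_left (pow_le_pow_left₀ (abs_nonneg _) hD _) hC0

lemma algebra_bound {ux uy ut p q r s X Y D E m C B : ℝ} (hp : ut = ux + p + r)
    (hq : ut = uy + q + s) (h1 : |ux| ≤ X) (h2 : |uy| ≤ Y) (hut : |ut| ≤ B)
    (hpb : |p| ≤ m * D * X) (hqb : |q| ≤ m * D * Y) (hr : |r| ≤ C * E) (hs : |s| ≤ C * E)
    (hD0 : 0 ≤ D) (hD1 : D ≤ 1) (hE0 : 0 ≤ E) (hE1 : E ≤ 1) (hm : 0 ≤ m) (hC : 0 ≤ C) :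
    |ut * ut - ux * uy| ≤ (2 * m + m ^ 2) * (D * (X * Y)) + (2 * B * C + C ^ 2) * E := by
  have hX : 0 ≤ X := (abs_nonneg _).trans h1
  have hY : 0 ≤ Y := (abs_nonneg _).trans h2
  have hB : 0 ≤ B := (abs_nonneg _).trans hut
  have e : ut * ut - ux * uy = ux * q + p * uy + p * q + ut * s + ut * r - r * s := by
    have hux : ux = ut - p - r := by linarith
    have huy : uy = ut - q - s := by linarith
    rw [hux, huy]; ring
  have a1 : |ux * q| ≤ X * (m * D * Y) := by rw [abs_mul]; gcongr
  have a2 : |p * uy| ≤ (m * D * X) * Y := by rw [abs_mul]; gcongr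
  have a3 : |p * q| ≤ (m * D * X) * (m * D * Y) := by rw [abs_mul]; gcongr
  have a4 : |ut * s| ≤ B * (C * E) := by rw [abs_mul]; gcongr
  have a5 : |ut * r| ≤ B * (C * E) := by rw [abs_mul]; gcongr
  have a6 : |r * s| ≤ (C * E) * (C * E) := by rw [abs_mul]; gcongr
  have b3 : (m * D * X) * (m * D * Y) ≤ m ^ 2 * (D * (X * Y)) := by
    have : m ^ 2 * (D * (X * Y)) * D ≤ m ^ 2 * (D * (X * Y)) :=
      mul_le_of_le_one_right (by positivity) hD1
    linarith
  have b6 : (C * E) * (C * E) ≤ C ^ 2 * E := by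
    have : C ^ 2 * E * E ≤ C ^ 2 * E := mul_le_of_le_one_right (by positivity) hE1
    linarith
  rw [e]
  rw [abs_le] at *
  constructor <;> linarith [a1.1, a1.2, a2.1, a2.2, a3.1, a3.2, a4.1, a4.2, a5.1, a5.2, a6.1, a6.2]

lemma exists_mid {f : ℝ → ℝ} (hf : Differentiable ℝ f) (x y : ℝ) :
    ∃ t, |t - x| ≤ |x - y| ∧ |t - y| ≤ |x - y| ∧ f x - f y = (x - y) * deriv f t := by
  rcases lt_trichotomy x y with h | h | h
  · obtain ⟨t, ht, e⟩ := exists_deriv_eq_slope f h hf.continuous.continuousOn hf.differentiableOn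
    refine ⟨t, ?_, ?_, ?_⟩
    · rw [abs_of_pos (by linarith [ht.1]), abs_of_neg (by linarith)]; linarith [ht.2]
    · rw [abs_of_neg (by linarith [ht.2]), abs_of_neg (by linarith)]; linarith [ht.1]
    · rw [e]
      have : y - x ≠ 0 := by linarith
      field_simp
      ring
  · subst h; exact ⟨x, by simp⟩
  · obtain ⟨t, ht, e⟩ := exists_deriv_eq_slope f h hf.continuous.continuousOn hf.differentiableOn
    refine ⟨t, ?_, ?_, ?_⟩
    · rw [abs_of_neg (by linarith [ht.2]), abs_of_pos (by linarith)]; linarith [ht.1]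
    · rw [abs_of_pos (by linarith [ht.1]), abs_of_pos (by linarith)]; linarith [ht.2]
    · rw [e]
      have : x - y ≠ 0 := by linarith
      field_simp

lemma main_bound {a b : ℝ} {f u W : ℝ → ℝ} (hf : Differentiable ℝ f)
    (hfu : ∀ x, deriv f x = u x * u x) (h : SmoothSupp a b u) (m : ℕ)
    (hW0 : ∀ x, 0 ≤ W x) (hW : ∀ i < m + 1, ∀ x, |iteratedDeriv i u x| ≤ W x) :
    ∃ K, 0 ≤ K ∧ ∀ x y, |f x - f y - (x - y) * (u x * u y)| ≤
      K * (|x - y| ^ 2 * (W x * W y) + |x - y| ^ (m + 1 + 1)) := by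
  obtain ⟨C, hC0, hC⟩ := taylor_tail h m hW0 hW
  obtain ⟨B, hB0, hB⟩ := h.bdd
  refine ⟨(2 * m + m ^ 2) + (2 * B * C + C ^ 2) + 2 * B ^ 2, by positivity, fun x y => ?_⟩
  obtain ⟨t, ht1, ht2, e⟩ := exists_mid hf x y
  rw [e, hfu, ← mul_sub, abs_mul]
  set D := |x - y| with hD
  have hD0 : 0 ≤ D := abs_nonneg _
  have hWW : 0 ≤ W x * W y := mul_nonneg (hW0 x) (hW0 y)
  have hm0 : (0 : ℝ) ≤ m := Nat.cast_nonneg m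
  rcases le_or_gt D 1 with hD1 | hD1
  · obtain ⟨p, r, e1, hp, hr⟩ := hC x t D ht1 hD1
    obtain ⟨q, s, e2, hq, hs⟩ := hC y t D ht2 hD1
    have key := algebra_bound e1 e2 (by simpa using hW 0 (Nat.succ_pos _) x)
      (by simpa using hW 0 (Nat.succ_pos _) y) (hB t) hp hq hr hs hD0 hD1 (by positivity)
      (pow_le_one₀ hD0 hD1) hm0 hC0
    calc _ ≤ D * ((2 * m + m ^ 2) * (D * (W x * W y)) + (2 * B * C + C ^ 2) * D ^ (m + 1)) := by
          gcongr
      _ = (2 * m + m ^ 2) * (D ^ 2 * (W x * W y)) + (2 * B * C + C ^ 2) * D ^ (m + 1 + 1) := by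
          ring
      _ ≤ _ := by
          have h1 : 0 ≤ D ^ 2 * (W x * W y) := by positivity
          have h2 : 0 ≤ D ^ (m + 1 + 1) := by positivity
          have h3 : 0 ≤ 2 * (m : ℝ) + m ^ 2 := by positivity
          have h4 : 0 ≤ 2 * B * C + C ^ 2 := by positivity
          have h5 : 0 ≤ 2 * B ^ 2 := by positivity
          nlinarith [mul_nonneg h1 h4, mul_nonneg h2 h3, mul_nonneg h1 h5, mul_nonneg h2 h5]
  · have k1 : |u t * u t - u x * u y| ≤ 2 * B ^ 2 := by
      have a1 : |u t * u t| ≤ B * B := by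
        rw [abs_mul]; exact mul_le_mul (hB _) (hB _) (abs_nonneg _) hB0
      have a2 : |u x * u y| ≤ B * B := by
        rw [abs_mul]; exact mul_le_mul (hB _) (hB _) (abs_nonneg _) hB0
      have := abs_sub (u t * u t) (u x * u y)
      linarith
    calc D * |u t * u t - u x * u y| ≤ D ^ (m + 1 + 1) * (2 * B ^ 2) := by
          gcongr
          exact le_self_pow₀ hD1.le (by omega)
      _ ≤ _ := by
          have h1 : 0 ≤ D ^ 2 * (W x * W y) := by positivity
          have h2 : 0 ≤ D ^ (m + 1 + 1) := by positivity
          have h3 : 0 ≤ 2 * (m : ℝ) + m ^ 2 := by positivity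
          have h4 : 0 ≤ 2 * B * C + C ^ 2 := by positivity
          have h5 : 0 ≤ 2 * B ^ 2 := by positivity
          nlinarith [mul_nonneg h1 h4, mul_nonneg h2 h3, mul_nonneg h1 h5, mul_nonneg h2 h4,
            mul_nonneg h1 h3]

lemma exists_class {ε : ℝ} (hε : 0 < ε) {W : ℝ → ℝ} (hW : SmoothSupp (ε / 2) ε W)
    (hW0 : ∀ x, 0 ≤ W x) (hI : 0 < ∫ t in (0 : ℝ)..(2 * ε), W t ^ 2) :
    ∃ j, InClassE ε j ∧ ∃ c, 0 < c ∧ ∀ x, W x = c * √(deriv j x) := by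
  set I := ∫ t in (0 : ℝ)..(2 * ε), W t ^ 2 with hIdef
  have hcont : Continuous fun t => W t ^ 2 := hW.1.continuous.pow 2
  have hint : ∀ a b, IntervalIntegrable (fun t => W t ^ 2) MeasureTheory.volume a b :=
    fun a b => hcont.intervalIntegrable a b
  set j : ℝ → ℝ := fun x => (∫ t in (0 : ℝ)..x, W t ^ 2) / I with hj
  have hd : ∀ x, HasDerivAt j (W x ^ 2 / I) x := fun x =>
    (hcont.integral_hasStrictDerivAt 0 x).hasDerivAt.div_const I
  have hder : deriv j = fun x => W x ^ 2 / I := funext fun x => (hd x).deriv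
  have hsq : ∀ x, √(deriv j x) = W x / √I := by
    intro x
    rw [hder]
    simp only
    rw [Real.sqrt_div (sq_nonneg _), Real.sqrt_sq (hW0 x)]
  have hsI : 0 < √I := Real.sqrt_pos.2 hI
  have hlow : ∀ x, x < ε / 2 → j x = 0 := by
    intro x hx
    have : ∫ t in (0 : ℝ)..x, W t ^ 2 = ∫ t in (0 : ℝ)..x, (0 : ℝ) := by
      apply intervalIntegral.integral_congr
      intro t ht
      have h2 := ht.2
      have : t < ε / 2 := lt_of_le_of_lt h2 (max_lt (by linarith) hx)
      simp [hW.2.1 t this]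
    simp [hj, this]
  have hhigh : ∀ x, ε < x → j x = 1 := by
    intro x hx
    have h0 : ∫ t in (2 * ε)..x, W t ^ 2 = ∫ t in (2 * ε)..x, (0 : ℝ) := by
      apply intervalIntegral.integral_congr
      intro t ht
      have h2 := ht.1
      have : ε < t := lt_of_lt_of_le (lt_min (by linarith) hx) h2
      simp [hW.2.2 t this]
    have h1 := intervalIntegral.integral_add_adjacent_intervals (hint 0 (2 * ε)) (hint (2 * ε) x)
    rw [h0] at h1
    simp only [intervalIntegral.integral_zero, add_zero] at h1
    simp only [hj, ← h1]
    exact div_self hI.ne'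
  have hder0 : ∀ x, 0 ≤ deriv j x := by
    intro x; rw [hder]; positivity
  have hdiff : Differentiable ℝ j := fun x => (hd x).differentiableAt
  refine ⟨j, ⟨?_, ?_, hder0, ?_, hlow, hhigh⟩, √I, hsI, ?_⟩
  · refine contDiff_infty_iff_deriv.2 ⟨hdiff, ?_⟩
    rw [hder]
    exact (hW.1.pow 2).div_const I
  · intro x
    have hmono := monotone_of_deriv_nonneg hdiff hder0
    have h0 := hlow (min x 0) (lt_of_le_of_lt (min_le_right _ _) (by linarith))
    rw [← h0]
    exact hmono (min_le_left _ _)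
  · simp only [hsq]
    exact hW.1.div_const _
  · intro x
    rw [hsq]
    field_simp

theorem symmetrized_expansion
    (ε : ℝ) (hε : 0 < ε) (n : ℕ) (hn : 1 ≤ n) (f : ℝ → ℝ) (hf : InClassE ε f) :
    ∃ (j : ℕ → ℝ → ℝ) (h : ℕ → ℝ → ℝ → ℝ) (Rn : ℝ → ℝ → ℝ) (C : ℕ → ℝ),
      (∀ k ∈ Finset.Icc 2 n, InClassE ε (j k)) ∧
      (∀ k ∈ Finset.Icc 2 n, 0 < C k) ∧ 0 < C n ∧
      (∀ x y : ℝ,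
        f x - f y
          = (x - y) * (Real.sqrt (deriv f x) * Real.sqrt (deriv f y))
            + ∑ k ∈ Finset.Icc 2 n, (x - y) ^ k * h k x y
            + Rn x y * (x - y) ^ (n + 1)) ∧
      (∀ k ∈ Finset.Icc 2 n, ∀ x y : ℝ,
        |h k x y| ≤ C k * (Real.sqrt (deriv (j k) x) * Real.sqrt (deriv (j k) y))) ∧
      (∀ x y : ℝ, |Rn x y| ≤ C n) := by
  obtain ⟨m, rfl⟩ : ∃ m, n = m + 1 := ⟨n - 1, by omega⟩
  obtain ⟨hf1, hf2, hf3, hf4, hf5, hf6⟩ := hf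
  set u : ℝ → ℝ := fun x => √(deriv f x) with hu
  have hfu : ∀ x, deriv f x = u x * u x := fun x => (Real.mul_self_sqrt (hf3 x)).symm
  have hus : SmoothSupp (ε / 2) ε u := by
    refine ⟨hf4, fun x hx => ?_, fun x hx => ?_⟩
    · simp [hu, deriv_zero_left hf5 x hx]
    · simp [hu, deriv_zero_right hf6 x hx]
  obtain ⟨W, hW1, hW0, hW⟩ := majorant_all hus (m + 1)
  obtain ⟨K, hK0, hK⟩ := main_bound (smooth_diff hf1) hfu hus m hW0 hW
  have hI : 0 < ∫ t in (0 : ℝ)..(2 * ε), W t ^ 2 := by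
    have h1 : ∫ t in (0 : ℝ)..(2 * ε), deriv f t = 1 := by
      rw [intervalIntegral.integral_eq_sub_of_hasDerivAt (f := f)
        (fun x _ => (smooth_diff hf1 x).hasDerivAt)
        ((smooth_deriv hf1).continuous.intervalIntegrable _ _),
        hf5 0 (by linarith), hf6 _ (by linarith)]
      simp
    have h2 : ∫ t in (0 : ℝ)..(2 * ε), deriv f t ≤ ∫ t in (0 : ℝ)..(2 * ε), W t ^ 2 := by
      apply intervalIntegral.integral_mono_on (by linarith)
        ((smooth_deriv hf1).continuous.intervalIntegrable _ _)
        ((hW1.1.continuous.pow 2).intervalIntegrable _ _)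
      intro x _
      have := hW 0 (Nat.succ_pos _) x
      rw [iteratedDeriv_zero] at this
      rw [hfu, ← sq, ← sq_abs]
      exact pow_le_pow_left₀ (abs_nonneg _) this 2
    linarith
  obtain ⟨J, hJ, c, hc, hWc⟩ := exists_class hε hW1 hW0 hI
  set G : ℝ → ℝ → ℝ := fun x y => f x - f y - (x - y) * (u x * u y) with hG
  obtain ⟨B, hB0, hB⟩ := hW1.bdd
  rcases Nat.eq_zero_or_pos m with rfl | hm
  · -- the case without middle terms
    refine ⟨fun _ => J, fun _ _ _ => 0, fun x y => G x y / (x - y) ^ 2,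
      fun _ => K * (B * B + 1) + 1, by simp, by simp, by positivity, ?_, by simp, ?_⟩
    · intro x y
      rcases eq_or_ne x y with rfl | hxy
      · simp
      · have : (x - y) ^ 2 ≠ 0 := pow_ne_zero _ (sub_ne_zero.2 hxy)
        simp only [Nat.zero_add, one_add_one_eq_two]
        rw [div_mul_cancel₀ _ this]
        simp [hG, hu]
    · intro x y
      have h1 := hK x y
      have h2 : W x * W y ≤ B * B :=
        mul_le_mul ((le_abs_self _).trans (hB x)) ((le_abs_self _).trans (hB y)) (hW0 y) hB0
      rw [abs_div, abs_pow]
      refine div_le_of_le_mul₀ (by positivity) (by positivity) (h1.trans ?_)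
      simp only [Nat.zero_add, one_add_one_eq_two]
      have h3 : 0 ≤ |x - y| ^ 2 := by positivity
      calc K * (|x - y| ^ 2 * (W x * W y) + |x - y| ^ 2)
          ≤ K * (|x - y| ^ 2 * (B * B) + |x - y| ^ 2) := by gcongr
        _ ≤ _ := by linarith
  · set S : ℝ → ℝ → ℝ := fun x y => |x - y| ^ 2 * (W x * W y) + |x - y| ^ (m + 1 + 1) with hS
    have hS0 : ∀ x y, 0 ≤ S x y := fun x y => by
      have := hW0 x
      have := hW0 y
      positivity
    have hGS : ∀ x y, |G x y / S x y| ≤ K := by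
      intro x y
      rw [abs_div, abs_of_nonneg (hS0 x y)]
      exact div_le_of_le_mul₀ (hS0 x y) hK0 (hK x y)
    have hGeq : ∀ x y, G x y = G x y / S x y * S x y := by
      intro x y
      rcases eq_or_ne (S x y) 0 with h0 | h0
      · have := hK x y
        change |G x y| ≤ K * S x y at this
        rw [h0, mul_zero] at this
        rw [h0, mul_zero]
        exact abs_nonpos_iff.1 this
      · exact (div_mul_cancel₀ _ h0).symm
    set σ : ℝ → ℝ → ℝ := fun x y => if 0 ≤ x - y then 1 else -1 with hσ
    have hσ1 : ∀ x y, |σ x y| = 1 := by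
      intro x y; simp only [hσ]; split_ifs <;> simp
    have hσ2 : ∀ x y, |x - y| = σ x y * (x - y) := by
      intro x y; simp only [hσ]; split_ifs with h0
      · rw [abs_of_nonneg h0, one_mul]
      · rw [abs_of_neg (not_le.1 h0)]; ring
    refine ⟨fun _ => J, fun k x y => if k = 2 then G x y / S x y * (W x * W y) else 0,
      fun x y => G x y / S x y * σ x y ^ (m + 1 + 1), fun _ => K * (c * c) + K + 1,
      fun _ _ => hJ, fun _ _ => by positivity, by positivity, ?_, ?_, ?_⟩
    · intro x y
      have h2 : (2 : ℕ) ∈ Finset.Icc 2 (m + 1) := by simp; omega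
      simp only [mul_ite, mul_zero]
      rw [Finset.sum_ite_eq' , if_pos h2]
      have h1 := hGeq x y
      have h3 : S x y = (x - y) ^ 2 * (W x * W y) + σ x y ^ (m + 1 + 1) * (x - y) ^ (m + 1 + 1) := by
        simp only [hS]
        rw [sq_abs, hσ2 x y, mul_pow]
      have h4 : f x - f y = (x - y) * (u x * u y) + G x y := by simp only [hG]; ring
      rw [h4]
      change (x - y) * (u x * u y) + G x y = (x - y) * (u x * u y) + _ + _
      rw [add_assoc]
      congr 1
      calc G x y = G x y / S x y * S x y := h1
        _ = G x y / S x y * ((x - y) ^ 2 * (W x * W y)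
            + σ x y ^ (m + 1 + 1) * (x - y) ^ (m + 1 + 1)) := by rw [← h3]
        _ = _ := by ring
    · intro k _ x y
      have hn0 : 0 ≤ √(deriv J x) * √(deriv J y) := by positivity
      simp only
      split_ifs with hk
      · rw [abs_mul, abs_of_nonneg (mul_nonneg (hW0 x) (hW0 y)), hWc x, hWc y]
        calc _ ≤ K * (c * √(deriv J x) * (c * √(deriv J y))) := by
              gcongr
              exact hGS x y
          _ = K * (c * c) * (√(deriv J x) * √(deriv J y)) := by ring
          _ ≤ _ := by
              apply mul_le_mul_of_nonneg_right _ hn0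
              linarith
      · rw [abs_zero]; positivity
    · intro x y
      rw [abs_mul, abs_pow, hσ1, one_pow, mul_one]
      have : 0 ≤ K * (c * c) := by positivity
      linarith [hGS x y]
end

section
/- Let ε > 0 and f₁, f₂ ∈ 𝓔_ε. Then there exist a constant C > 0 and a function f₃ ∈ 𝓔_ε such that f₁(x) + f₂(x) ≤ C f₃(x) for all x ∈ ℝ. -/
theorem sqrt_deriv_zero (f : ℝ → ℝ) (c : ℝ) (s : Set ℝ) (hs : IsOpen s)
    (h : ∀ x ∈ s, f x = c) (x : ℝ) (hx : x ∈ s) : Real.sqrt (deriv f x) = 0 := by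
  have : f =ᶠ[nhds x] fun _ => c := Filter.eventuallyEq_of_mem (hs.mem_nhds hx) h
  rw [this.deriv_eq]
  simp

/-- for `f₁, f₂ ∈ 𝓔_ε` there are `C > 0` and `f₃ ∈ 𝓔_ε`
with `f₁ + f₂ ≤ C f₃` pointwise. -/
theorem sum_dominated_by_classE
    (ε : ℝ) (hε : 0 < ε) (f₁ f₂ : ℝ → ℝ) (hf₁ : InClassE ε f₁) (hf₂ : InClassE ε f₂) :
    ∃ (C : ℝ) (f₃ : ℝ → ℝ), 0 < C ∧ InClassE ε f₃ ∧
      ∀ x : ℝ, f₁ x + f₂ x ≤ C * f₃ x := by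
  obtain ⟨s1, p1, d1, r1, z1, o1⟩ := hf₁
  obtain ⟨s2, p2, d2, r2, z2, o2⟩ := hf₂
  obtain ⟨h, hh⟩ : ∃ h : ℝ → ℝ, h = fun x => Real.sqrt (deriv f₁ x) + Real.sqrt (deriv f₂ x) :=
    ⟨_, rfl⟩
  have hs : ContDiff ℝ (⊤ : ℕ∞) h := by rw [hh]; exact r1.add r2
  have hn : ∀ x, 0 ≤ h x := fun x => by rw [hh]; positivity
  have hlo : ∀ x, x < ε / 2 → h x = 0 := fun x hx => by
    rw [hh]
    simp only [sqrt_deriv_zero f₁ 0 (Set.Iio (ε/2)) isOpen_Iio z1 x hx,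
      sqrt_deriv_zero f₂ 0 (Set.Iio (ε/2)) isOpen_Iio z2 x hx, add_zero]
  have hhi : ∀ x, ε < x → h x = 0 := fun x hx => by
    rw [hh]
    simp only [sqrt_deriv_zero f₁ 1 (Set.Ioi ε) isOpen_Ioi o1 x hx,
      sqrt_deriv_zero f₂ 1 (Set.Ioi ε) isOpen_Ioi o2 x hx, add_zero]
  have hge : ∀ x, deriv f₁ x + deriv f₂ x ≤ h x ^ 2 := fun x => by
    rw [hh]
    have a := Real.sq_sqrt (d1 x)
    have b := Real.sq_sqrt (d2 x)
    have c := mul_nonneg (Real.sqrt_nonneg (deriv f₁ x)) (Real.sqrt_nonneg (deriv f₂ x))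
    simp only
    nlinarith
  have hc : Continuous fun x => h x ^ 2 := hs.continuous.pow 2
  obtain ⟨G, hG⟩ : ∃ G : ℝ → ℝ, G = fun x => ∫ t in (0:ℝ)..x, h t ^ 2 := ⟨_, rfl⟩
  have hd : ∀ x, HasDerivAt G (h x ^ 2) x := fun x => by
    rw [hG]
    exact intervalIntegral.integral_hasDerivAt_right (hc.intervalIntegrable _ _)
      (hc.stronglyMeasurableAtFilter _ _) hc.continuousAt
  have hdG : deriv G = fun x => h x ^ 2 := funext fun x => (hd x).deriv
  have hGs : ContDiff ℝ (⊤ : ℕ∞) G := by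
    rw [contDiff_infty_iff_deriv]
    refine ⟨fun x => (hd x).differentiableAt, ?_⟩
    rw [hdG]
    exact hs.pow 2
  have hGlo : ∀ x, x < ε / 2 → G x = 0 := fun x hx => by
    rw [hG]
    apply intervalIntegral.integral_zero_ae
    refine Filter.Eventually.of_forall fun t ht => ?_
    have : t ≤ max 0 x := ht.2
    rw [hlo t (lt_of_le_of_lt this (max_lt (by linarith) hx))]
    simp
  have hGhi : ∀ x, ε < x → G x = G (2 * ε) := fun x hx => by
    have e : G x - G (2 * ε) = ∫ t in (2 * ε)..x, h t ^ 2 := by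
      rw [hG]
      exact intervalIntegral.integral_interval_sub_left (hc.intervalIntegrable _ _)
        (hc.intervalIntegrable _ _)
    have e2 : ∫ t in (2 * ε)..x, h t ^ 2 = 0 := by
      apply intervalIntegral.integral_zero_ae
      refine Filter.Eventually.of_forall fun t ht => ?_
      have : min (2 * ε) x < t := ht.1
      rw [hhi t (lt_trans (lt_min (by linarith) hx) this)]
      simp
    linarith
  have hmono : Monotone fun x => G x - (f₁ x + f₂ x) := by
    have D : ∀ x, HasDerivAt (fun x => G x - (f₁ x + f₂ x))
        (h x ^ 2 - (deriv f₁ x + deriv f₂ x)) x := fun x =>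
      (hd x).sub (((s1.differentiable (by simp)) x).hasDerivAt.add
        ((s2.differentiable (by simp)) x).hasDerivAt)
    refine monotone_of_deriv_nonneg (fun x => (D x).differentiableAt) fun x => ?_
    rw [(D x).deriv]
    linarith [hge x]
  have hle : ∀ x, f₁ x + f₂ x ≤ G x := fun x => by
    by_cases hx : x < ε / 2
    · rw [z1 x hx, z2 x hx, hGlo x hx]; simp
    · have h0 : (0:ℝ) < ε / 2 := by linarith
      have := hmono (show (0:ℝ) ≤ x by linarith)
      simp only [z1 0 h0, z2 0 h0, hGlo 0 h0] at this
      linarith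
  have hK : 0 < G (2 * ε) := by
    have := hle (2 * ε)
    rw [o1 _ (by linarith), o2 _ (by linarith)] at this
    linarith
  have hdF : deriv (fun x => G x / G (2 * ε)) = fun x => h x ^ 2 / G (2 * ε) :=
    funext fun x => ((hd x).div_const _).deriv
  refine ⟨G (2 * ε), fun x => G x / G (2 * ε), hK, ⟨hGs.div_const _, fun x => ?_, fun x => ?_, ?_,
    fun x hx => ?_, fun x hx => ?_⟩, fun x => ?_⟩
  · exact div_nonneg (le_trans (add_nonneg (p1 x) (p2 x)) (hle x)) hK.le
  · rw [hdF]; positivity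
  · rw [hdF]
    have : (fun x => Real.sqrt (h x ^ 2 / G (2 * ε))) = fun x => h x / Real.sqrt (G (2 * ε)) := by
      funext x
      rw [Real.sqrt_div (sq_nonneg _), Real.sqrt_sq (hn x)]
    simp only [this]
    exact hs.div_const _
  · simp [hGlo x hx]
  · simp only [hGhi x hx]
    exact div_self hK.ne'
  · rw [mul_div_cancel₀ _ hK.ne']
    exact hle x
end

section
/- Let ε > 0 and let h : ℝ → ℝ be a smooth function with h ≥ 0, h not identically zero, support of h contained in (ε/2, ε), and √h ∈ C^∞(ℝ). Then the function f(λ) := (∫_{−∞}^λ h(s) ds) / (∫_{−∞}^{∞} h(s) ds) belongs to 𝓔_ε. Moreover, for every smooth h : ℝ → ℝ with h ≥ 0 and support contained in (ε/2, ε) (without assuming √h smooth), there exist a constant C > 0 and a function f ∈ 𝓔_ε such that h(x) ≤ C f'(x) for all x ∈ ℝ. -/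
open MeasureTheory

lemma aux_primitive (ε : ℝ) (hε : 0 < ε) (h : ℝ → ℝ)
    (hsm : ContDiff ℝ (⊤ : ℕ∞) h) (hpos : ∀ x, 0 ≤ h x) (hne : ∃ x, h x ≠ 0)
    (hsupp : Function.support h ⊆ Set.Ioo (ε / 2) ε)
    (hsqrt : ContDiff ℝ (⊤ : ℕ∞) fun x => Real.sqrt (h x)) :
    InClassE ε (fun l => (∫ s in Set.Iic l, h s) / (∫ s : ℝ, h s)) ∧ 0 < (∫ s : ℝ, h s) ∧
    ∀ x, deriv (fun l => (∫ s in Set.Iic l, h s) / (∫ s : ℝ, h s)) x = h x / (∫ s : ℝ, h s) := by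
  have hz : ∀ x, x ∉ Set.Ioo (ε / 2) ε → h x = 0 := fun x hx => by
    by_contra h0
    exact hx (hsupp h0)
  have hcs : HasCompactSupport h :=
    HasCompactSupport.intro (isCompact_Icc (a := ε / 2) (b := ε))
      (fun x hx => hz x (fun hx' => hx (Set.Ioo_subset_Icc_self hx')))
  have hc : Continuous h := hsm.continuous
  have hint : Integrable h := hc.integrable_of_hasCompactSupport hcs
  have hI : 0 < ∫ s : ℝ, h s := by
    obtain ⟨x, hx⟩ := hne
    exact hc.integral_pos_of_hasCompactSupport_nonneg_nonzero hcs hpos hx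
  have h0 : ∀ l, l ≤ ε / 2 → ∫ s in Set.Iic l, h s = 0 := fun l hl => by
    apply setIntegral_eq_zero_of_forall_eq_zero
    intro x hx
    exact hz x (fun h' => by have := h'.1; have := Set.mem_Iic.1 hx; linarith)
  have hprim : (fun l => ∫ s in Set.Iic l, h s) = fun l => ∫ s in (ε/2)..l, h s := by
    funext l
    rw [← intervalIntegral.integral_Iic_sub_Iic hint.integrableOn hint.integrableOn,
      h0 _ le_rfl, sub_zero]
  have hder : ∀ x, HasDerivAt (fun l => (∫ s in Set.Iic l, h s) / (∫ s : ℝ, h s))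
      (h x / (∫ s : ℝ, h s)) x := fun x => by
    apply HasDerivAt.div_const
    rw [hprim]
    exact intervalIntegral.integral_hasDerivAt_right (hc.intervalIntegrable _ _)
      (hc.stronglyMeasurableAtFilter _ _) hc.continuousAt
  have hder' : deriv (fun l => (∫ s in Set.Iic l, h s) / (∫ s : ℝ, h s)) =
      fun x => h x / (∫ s : ℝ, h s) := funext fun x => (hder x).deriv
  refine ⟨⟨?_, ?_, ?_, ?_, ?_, ?_⟩, hI, fun x => (hder x).deriv⟩
  · rw [contDiff_infty_iff_deriv, hder']
    exact ⟨fun x => (hder x).differentiableAt, hsm.div_const _⟩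
  · intro x
    exact div_nonneg (integral_nonneg hpos) hI.le
  · intro x
    rw [hder']
    exact div_nonneg (hpos x) hI.le
  · rw [hder']
    simp_rw [Real.sqrt_div (hpos _)]
    exact hsqrt.div_const _
  · intro x hx
    simp [h0 x hx.le]
  · intro x hx
    have : ∫ s in Set.Iic x, h s = ∫ s, h s := by
      apply setIntegral_eq_integral_of_forall_compl_eq_zero
      intro y hy
      exact hz y (fun h' => by have := h'.2; have := not_le.1 (fun h => hy (Set.mem_Iic.2 h)); linarith)
    simp only [this]
    exact div_self hI.ne'

lemma aux_flat (n : ℕ) : ∀ (g : ℝ → ℝ), ContDiff ℝ (⊤ : ℕ∞) g → (∀ x, x ≤ 0 → g x = 0) →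
    ∃ C : ℝ, 0 ≤ C ∧ ∀ x ∈ Set.Icc (0:ℝ) 1, |g x| ≤ C * x ^ n := by
  induction n with
  | zero =>
    intro g hg _
    obtain ⟨C, hC⟩ := (isCompact_Icc (a := (0:ℝ)) (b := 1)).exists_bound_of_continuousOn
      hg.continuous.continuousOn
    refine ⟨C, (norm_nonneg _).trans (hC 0 (by simp)), fun x hx => ?_⟩
    simpa using hC x hx
  | succ n ih =>
    intro g hg h0
    have hd := contDiff_infty_iff_deriv.1 hg
    have hlt : ∀ x, x < 0 → deriv g x = 0 := fun x hx => by
      have : g =ᶠ[nhds x] fun _ => 0 := by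
        filter_upwards [Iio_mem_nhds hx] with y hy
        exact h0 y (le_of_lt hy)
      rw [this.deriv_eq]; simp
    have hle : ∀ x, x ≤ 0 → deriv g x = 0 := by
      have hcl : IsClosed {x | deriv g x = 0} := isClosed_eq hd.2.continuous continuous_const
      have : closure (Set.Iio (0:ℝ)) ⊆ {x | deriv g x = 0} := closure_minimal hlt hcl
      rw [closure_Iio] at this
      exact this
    obtain ⟨C, hC0, hC⟩ := ih _ hd.2 hle
    refine ⟨C, hC0, fun x hx => ?_⟩
    have := norm_image_sub_le_of_norm_deriv_le_segment' (f := g) (f' := deriv g) (a := 0) (b := x)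
      (C := C * x ^ n) (fun y _ => (hd.1 y).hasDerivAt.hasDerivWithinAt)
      (fun y hy => (hC y ⟨hy.1, hy.2.le.trans hx.2⟩).trans (by
        have := hy.1; have := hy.2.le; gcongr)) x ⟨hx.1, le_rfl⟩
    rw [h0 0 le_rfl, sub_zero, sub_zero, mul_assoc, ← pow_succ] at this
    exact this

lemma aux_majorant (w : ℝ → ℝ) (B : ℝ) (hw0 : ∀ x, 0 ≤ w x) (hwB : ∀ x, w x ≤ B)
    (hflat : ∀ n : ℕ, ∃ C : ℝ, 0 ≤ C ∧ ∀ x ∈ Set.Icc (0:ℝ) 1, w x ≤ C * x ^ n) :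
    ∃ K : ℝ → ℝ, ContDiff ℝ (⊤ : ℕ∞) K ∧ (∀ x, 0 ≤ K x) ∧ (∀ x, x ≤ 0 → K x = 0) ∧
      (∀ x, 0 < x → 0 < K x) ∧ ∀ x, 0 < x → w x ≤ K x := by
  let φ : ContDiffBump (3 / 4 : ℝ) := ⟨1 / 4, 1 / 2, by norm_num, by norm_num⟩
  have hφ1 : ∀ x, 1 / 2 ≤ x → x ≤ 1 → φ x = 1 := fun x h1 h2 => by
    apply φ.one_of_mem_closedBall
    rw [Real.closedBall_eq_Icc]
    constructor <;> (simp only [φ]; linarith)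
  have hφ0 : ∀ x, x ≤ 0 → φ x = 0 := fun x h1 => by
    apply φ.zero_of_le_dist
    rw [Real.dist_eq, abs_of_nonpos (by linarith)]
    simp only [φ]; linarith
  have hφs : ∀ n : ℕ∞, ContDiff ℝ n φ := fun n => φ.contDiff
  have hM : ∀ k : ℕ, ∃ M : ℝ, ∀ x, ‖iteratedDeriv k φ x‖ ≤ M := fun k => by
    obtain ⟨M, hM⟩ := (φ.hasCompactSupport.iteratedFDeriv (𝕜 := ℝ) k).exists_bound_of_continuous
      ((hφs k).continuous_iteratedFDeriv le_rfl)
    exact ⟨M, fun x => by rw [← norm_iteratedFDeriv_eq_norm_iteratedDeriv]; exact hM x⟩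
  choose M hM using hM
  let a : ℕ → ℝ := fun j => sSup (w '' Set.Ioc 0 ((1/2:ℝ)^j))
  have hbdd : ∀ j, BddAbove (w '' Set.Ioc 0 ((1/2:ℝ)^j)) := fun j =>
    ⟨B, by rintro _ ⟨x, _, rfl⟩; exact hwB x⟩
  have ha : ∀ j x, 0 < x → x ≤ (1/2:ℝ)^j → w x ≤ a j := fun j x h1 h2 =>
    le_csSup (hbdd j) ⟨x, ⟨h1, h2⟩, rfl⟩
  have ha0 : ∀ j, 0 ≤ a j := fun j => (hw0 _).trans (ha j ((1/2)^j) (by positivity) le_rfl)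
  choose C hC0 hC using hflat
  have haC : ∀ n j, a j ≤ C n * ((1/2:ℝ)^j)^n := fun n j => by
    apply csSup_le
    · exact ⟨_, (1/2:ℝ)^j, ⟨by positivity, le_rfl⟩, rfl⟩
    · rintro _ ⟨x, hx, rfl⟩
      have h1 : (1/2:ℝ)^j ≤ 1 := pow_le_one₀ (by norm_num) (by norm_num)
      refine (hC n x ⟨hx.1.le, hx.2.trans h1⟩).trans ?_
      have := hC0 n; have := hx.1.le; have := hx.2
      gcongr
  have hb : ∀ (k j : ℕ) (x : ℝ), ‖iteratedFDeriv ℝ k (fun x => a j * φ (2 ^ j * x)) x‖ ≤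
      C (k + 1) * M k * (1/2:ℝ)^j := fun k j x => by
    rw [norm_iteratedFDeriv_eq_norm_iteratedDeriv, iteratedDeriv_const_mul_field,
      iteratedDeriv_comp_const_mul (hφs k), norm_mul, norm_mul, Real.norm_of_nonneg (ha0 j),
      Real.norm_of_nonneg (by positivity)]
    have hM0 := (norm_nonneg _).trans (hM k (2 ^ j * x))
    calc a j * ((2 ^ j) ^ k * ‖iteratedDeriv k φ (2 ^ j * x)‖)
        ≤ (C (k+1) * ((1/2:ℝ)^j)^(k+1)) * ((2 ^ j) ^ k * M k) := by
          have := hC0 (k+1)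
          gcongr
          · exact haC _ _
          · exact hM _ _
      _ = C (k + 1) * M k * (1/2:ℝ)^j * (((1/2:ℝ)^j * 2 ^ j)^k) := by ring
      _ = _ := by rw [← mul_pow]; norm_num
  have hsum : ∀ k, Summable fun j : ℕ => C (k + 1) * M k * (1/2:ℝ)^j := fun k =>
    (summable_geometric_of_lt_one (by norm_num) (by norm_num)).mul_left _
  have hS : ContDiff ℝ (⊤ : ℕ∞) fun x => ∑' j : ℕ, a j * φ (2 ^ j * x) := by
    apply contDiff_tsum (v := fun k j => C (k + 1) * M k * (1/2:ℝ)^j)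
    · intro j
      exact contDiff_const.mul ((hφs _).comp (contDiff_const.mul contDiff_id))
    · intro k _
      exact hsum k
    · intro k j x _
      exact hb k j x
  have hterm : ∀ j x, 0 ≤ a j * φ (2 ^ j * x) := fun j x => mul_nonneg (ha0 j) φ.nonneg
  have hsx : ∀ x, Summable fun j : ℕ => a j * φ (2 ^ j * x) := fun x => by
    refine Summable.of_nonneg_of_le (fun j => hterm j x) (fun j => ?_) (hsum 0)
    have := hb 0 j x
    rw [norm_iteratedFDeriv_zero] at this
    exact (le_abs_self _).trans this
  have hB : 0 ≤ B := (hw0 0).trans (hwB 0)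
  have hS0 : ∀ x, 0 ≤ ∑' j : ℕ, a j * φ (2 ^ j * x) := fun x => tsum_nonneg (fun j => hterm j x)
  refine ⟨fun x => (∑' j : ℕ, a j * φ (2 ^ j * x)) + (B + 1) * Real.smoothTransition x,
    hS.add (contDiff_const.mul Real.smoothTransition.contDiff), ?_, ?_, ?_, ?_⟩
  · intro x
    have := hS0 x
    have := Real.smoothTransition.nonneg x
    positivity
  · intro x hx
    have : ∀ j : ℕ, a j * φ (2 ^ j * x) = 0 := fun j => by
      rw [hφ0 _ (mul_nonpos_of_nonneg_of_nonpos (by positivity) hx), mul_zero]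
    simp [this, Real.smoothTransition.zero_of_nonpos hx]
  · intro x hx
    have := hS0 x
    have := Real.smoothTransition.pos_of_pos hx
    positivity
  · intro x hx
    rcases le_total x 1 with h1 | h1
    · obtain ⟨n, hn1, hn2⟩ := exists_nat_pow_near_of_lt_one hx h1
        (by norm_num : (0:ℝ) < 1/2) (by norm_num)
      have hp : (2:ℝ)^n * (1/2)^n = 1 := by rw [← mul_pow]; norm_num
      have h2 : (0:ℝ) < 2 ^ n := by positivity
      have e1 : φ (2 ^ n * x) = 1 := by
        apply hφ1
        · have := mul_le_mul_of_nonneg_left hn1.le h2.le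
          rw [pow_succ, ← mul_assoc, hp] at this
          linarith
        · have := mul_le_mul_of_nonneg_left hn2 h2.le
          linarith
      have h3 := (hsx x).le_tsum n (fun j _ => hterm j x)
      rw [e1, mul_one] at h3
      have h4 := ha n x hx hn2
      have := mul_nonneg (by linarith : 0 ≤ B + 1) (Real.smoothTransition.nonneg x)
      simp only
      linarith
    · have := hS0 x
      have := hwB x
      simp only [Real.smoothTransition.one_of_one_le h1]
      linarith

/-- One-sided majorant of the fourth root of a smooth function vanishing on `(-∞, 0]`. -/
lemma aux_root (g : ℝ → ℝ) (hg : ContDiff ℝ (⊤ : ℕ∞) g) (hg0 : ∀ x, 0 ≤ g x)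
    (hz : ∀ x, x ≤ 0 → g x = 0) (B : ℝ) (hB : ∀ x, g x ≤ B) :
    ∃ K : ℝ → ℝ, ContDiff ℝ (⊤ : ℕ∞) K ∧ (∀ x, 0 ≤ K x) ∧ (∀ x, x ≤ 0 → K x = 0) ∧
      (∀ x, 0 < x → 0 < K x) ∧ ∀ x, 0 < x → √(√(g x)) ≤ K x := by
  apply aux_majorant (fun x => √(√(g x))) (√(√B)) (fun x => Real.sqrt_nonneg _)
    (fun x => Real.sqrt_le_sqrt (Real.sqrt_le_sqrt (hB x)))
  intro n
  obtain ⟨C, hC0, hC⟩ := aux_flat (4 * n) g hg hz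
  refine ⟨√(√C), Real.sqrt_nonneg _, fun x hx => ?_⟩
  have h1 : g x ≤ C * (x ^ n) ^ 4 := by
    rw [← pow_mul, mul_comm n 4]
    exact (le_abs_self _).trans (hC x hx)
  have h2 : 0 ≤ x ^ n := pow_nonneg hx.1 n
  have e : √(√(C * (x ^ n) ^ 4)) = √(√C) * x ^ n := by
    rw [Real.sqrt_mul hC0, show (x ^ n) ^ 4 = ((x ^ n) ^ 2) ^ 2 by ring,
      Real.sqrt_sq (by positivity), Real.sqrt_mul (by positivity), Real.sqrt_sq h2]
  rw [← e]
  exact Real.sqrt_le_sqrt (Real.sqrt_le_sqrt h1)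

/-- the normalized primitive of a smooth nonnegative bump `h` supported in
`(ε/2, ε)` with smooth square root lies in `𝓔_ε`; moreover every smooth nonnegative `g`
supported in `(ε/2, ε)` is dominated by `C f'` for some `C > 0` and `f ∈ 𝓔_ε`. -/
theorem classE_nonempty_and_domination
    (ε : ℝ) (hε : 0 < ε) (h : ℝ → ℝ)
    (hsm : ContDiff ℝ (⊤ : ℕ∞) h) (hpos : ∀ x, 0 ≤ h x) (hne : ∃ x, h x ≠ 0)
    (hsupp : Function.support h ⊆ Set.Ioo (ε / 2) ε)
    (hsqrt : ContDiff ℝ (⊤ : ℕ∞) fun x => Real.sqrt (h x)) :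
    InClassE ε (fun l => (∫ s in Set.Iic l, h s) / (∫ s : ℝ, h s)) ∧
      ∀ g : ℝ → ℝ, ContDiff ℝ (⊤ : ℕ∞) g → (∀ x, 0 ≤ g x) →
        Function.support g ⊆ Set.Ioo (ε / 2) ε →
        ∃ (C : ℝ) (f : ℝ → ℝ), 0 < C ∧ InClassE ε f ∧ ∀ x : ℝ, g x ≤ C * deriv f x := by
  refine ⟨(aux_primitive ε hε h hsm hpos hne hsupp hsqrt).1, fun g hg hg0 hgs => ?_⟩
  have hz : ∀ x, x ∉ Set.Ioo (ε / 2) ε → g x = 0 := fun x hx => by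
    by_contra h0
    exact hx (hgs h0)
  have hcs : HasCompactSupport g :=
    HasCompactSupport.intro (isCompact_Icc (a := ε / 2) (b := ε))
      (fun x hx => hz x (fun hx' => hx (Set.Ioo_subset_Icc_self hx')))
  obtain ⟨B, hB⟩ := hcs.exists_bound_of_continuous hg.continuous
  have hB' : ∀ x, g x ≤ B := fun x => (le_abs_self _).trans (hB x)
  obtain ⟨K, hK, hK0, hKz, hKp, hKg⟩ := aux_root (fun x => g (ε / 2 + x))
    (hg.comp (contDiff_const.add contDiff_id)) (fun x => hg0 _)
    (fun x hx => hz _ (fun h' => by have := h'.1; linarith)) B (fun x => hB' _)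
  obtain ⟨L, hL, hL0, hLz, hLp, hLg⟩ := aux_root (fun x => g (ε - x))
    (hg.comp (contDiff_const.sub contDiff_id)) (fun x => hg0 _)
    (fun x hx => hz _ (fun h' => by have := h'.2; linarith)) B (fun x => hB' _)
  let k : ℝ → ℝ := fun x => K (x - ε / 2) * L (ε - x)
  have hk : ContDiff ℝ (⊤ : ℕ∞) k :=
    (hK.comp (contDiff_id.sub contDiff_const)).mul (hL.comp (contDiff_const.sub contDiff_id))
  have hk0 : ∀ x, 0 ≤ k x := fun x => mul_nonneg (hK0 _) (hL0 _)
  have hkp : ∀ x ∈ Set.Ioo (ε / 2) ε, 0 < k x := fun x hx =>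
    mul_pos (hKp _ (by linarith [hx.1])) (hLp _ (by linarith [hx.2]))
  have hkg : ∀ x, g x ≤ k x ^ 2 := fun x => by
    by_cases hx : x ∈ Set.Ioo (ε / 2) ε
    · have h1 := hKg (x - ε / 2) (by linarith [hx.1])
      have h2 := hLg (ε - x) (by linarith [hx.2])
      simp only [add_sub_cancel, sub_sub_cancel] at h1 h2
      have h3 : √(g x) ≤ k x := by
        rw [← Real.mul_self_sqrt (Real.sqrt_nonneg (g x))]
        exact mul_le_mul h1 h2 (Real.sqrt_nonneg _) (hK0 _)
      exact (Real.sqrt_le_left (hk0 x)).1 h3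
    · rw [hz x hx]; positivity
  obtain ⟨h1, h2, h3⟩ := aux_primitive ε hε (fun x => k x ^ 2) (hk.pow 2) (fun x => sq_nonneg _)
    ⟨3 / 4 * ε, (pow_pos (hkp _ ⟨by linarith, by linarith⟩) 2).ne'⟩
    (by
      intro x hx
      by_contra hn
      apply hx
      have : k x = 0 := by
        by_cases h : ε / 2 < x
        · have : ε ≤ x := not_lt.1 fun h' => hn ⟨h, h'⟩
          simp [k, hLz (ε - x) (by linarith)]
        · simp [k, hKz (x - ε / 2) (by linarith)]
      simp [this])
    (by simpa only [Real.sqrt_sq (hk0 _)] using hk)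
  refine ⟨_, _, h2, h1, fun x => ?_⟩
  rw [h3, mul_div_cancel₀ _ h2.ne']
  exact hkg x
end

section
/- Let d ≥ 1, n ≥ 1 be integers, ε > 0, f ∈ 𝓔_ε, and u := √(f'). Suppose j_2, …, j_n ∈ 𝓔_ε, h_2, …, h_n : ℝ² → ℝ, R_n : ℝ² → ℝ, and C > 0 satisfy, for all a, b ∈ ℝ: f(a) − f(b) = (a − b) u(a) u(b) + Σ_{k=2}^n (a − b)^k h_k(a, b) + R_n(a, b)(a − b)^{n+1} and |R_n(a, b)| ≤ C (the sum being dropped for n = 1). Then for all R, s > 0, all t ≥ 0, v' ≥ 0, and all x, y ∈ ℝ^d, writing |z|_{ts} := (R − v't − |z|)/s for z ∈ ℝ^d: |f(|x|_{ts}) − f(|y|_{ts})| ≤ 2 [ (|x − y|/s) u(|x|_{ts}) u(|y|_{ts}) + Σ_{k=2}^n (|x − y|/s)^k |h_k(|x|_{ts}, |y|_{ts})| ] + C (|x − y|/s)^{n+1} ( χ_{B_{R−εs/2}}(x) + χ_{B_{R−εs/2}}(y) ). -/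
open scoped BigOperators

/-- The indicator function `χ_{B_r}` of the closed Euclidean ball of radius `r`. -/
noncomputable def ballInd (d : ℕ) (r : ℝ) (x : EuclideanSpace ℝ (Fin d)) : ℝ :=
  if ‖x‖ ≤ r then 1 else 0

/-- localized difference estimate for the ASTLO weight.  Given the
symmetrized expansion of `f ∈ 𝓔_ε` with remainder bound `|R_n| ≤ C`, writing
`|z|_{ts} = (R − v't − |z|)/s`, one has
`|f(|x|_{ts}) − f(|y|_{ts})| ≤ 2[(|x−y|/s) u(|x|_{ts})u(|y|_{ts}) +
Σ_{k=2}^n (|x−y|/s)^k |h_k|] + C (|x−y|/s)^{n+1} (χ_{B_{R−εs/2}}(x) + χ_{B_{R−εs/2}}(y))`. -/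
theorem astlo_difference_estimate
    (d n : ℕ) (hd : 1 ≤ d) (hn : 1 ≤ n) (ε : ℝ) (hε : 0 < ε)
    (f : ℝ → ℝ) (hf : InClassE ε f)
    (j : ℕ → ℝ → ℝ) (hj : ∀ k ∈ Finset.Icc 2 n, InClassE ε (j k))
    (h : ℕ → ℝ → ℝ → ℝ) (Rn : ℝ → ℝ → ℝ) (C : ℝ) (hC : 0 < C)
    (hexp : ∀ a b : ℝ,
      f a - f b
        = (a - b) * (Real.sqrt (deriv f a) * Real.sqrt (deriv f b))
          + ∑ k ∈ Finset.Icc 2 n, (a - b) ^ k * h k a b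
          + Rn a b * (a - b) ^ (n + 1))
    (hRn : ∀ a b : ℝ, |Rn a b| ≤ C) :
    ∀ (R s t v' : ℝ), 0 < R → 0 < s → 0 ≤ t → 0 ≤ v' →
      ∀ x y : EuclideanSpace ℝ (Fin d),
        |f ((R - v' * t - ‖x‖) / s) - f ((R - v' * t - ‖y‖) / s)|
          ≤ 2 * ((‖x - y‖ / s) *
                (Real.sqrt (deriv f ((R - v' * t - ‖x‖) / s)) *
                  Real.sqrt (deriv f ((R - v' * t - ‖y‖) / s)))
              + ∑ k ∈ Finset.Icc 2 n, (‖x - y‖ / s) ^ k *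
                  |h k ((R - v' * t - ‖x‖) / s) ((R - v' * t - ‖y‖) / s)|)
            + C * (‖x - y‖ / s) ^ (n + 1) *
              (ballInd d (R - ε * s / 2) x + ballInd d (R - ε * s / 2) y) := by
  intro R s t v' hR hs ht hv x y
  have hD : 0 ≤ ‖x - y‖ / s := by positivity
  have hfz : ∀ z : EuclideanSpace ℝ (Fin d), ¬ ‖z‖ ≤ R - ε * s / 2 →
      f ((R - v' * t - ‖z‖) / s) = 0 := by
    intro z hz
    apply hf.2.2.2.2.1
    rw [div_lt_iff₀ hs]
    have := mul_nonneg hv ht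
    push Not at hz
    linarith
  have hab : |(R - v' * t - ‖x‖) / s - (R - v' * t - ‖y‖) / s| ≤ ‖x - y‖ / s := by
    rw [← sub_div, abs_div, abs_of_pos hs]
    gcongr
    have := abs_norm_sub_norm_le x y
    rw [abs_sub_comm] at this
    rwa [show R - v' * t - ‖x‖ - (R - v' * t - ‖y‖) = ‖y‖ - ‖x‖ by ring]
  have hi0 : ∀ z : EuclideanSpace ℝ (Fin d), 0 ≤ ballInd d (R - ε * s / 2) z := by
    intro z
    unfold ballInd
    split_ifs <;> norm_num
  have hx0 := hfz x
  have hy0 := hfz y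
  have hE := hexp ((R - v' * t - ‖x‖) / s) ((R - v' * t - ‖y‖) / s)
  have hr := hRn ((R - v' * t - ‖x‖) / s) ((R - v' * t - ‖y‖) / s)
  have hI0 := add_nonneg (hi0 x) (hi0 y)
  have hcase : (¬ ‖x‖ ≤ R - ε * s / 2 ∧ ¬ ‖y‖ ≤ R - ε * s / 2) ∨
      1 ≤ ballInd d (R - ε * s / 2) x + ballInd d (R - ε * s / 2) y := by
    unfold ballInd
    split_ifs <;> simp_all
  generalize (R - v' * t - ‖x‖) / s = a at *
  generalize (R - v' * t - ‖y‖) / s = b at *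
  generalize ‖x - y‖ / s = D at *
  generalize ballInd d (R - ε * s / 2) x + ballInd d (R - ε * s / 2) y = I at *
  have hU : 0 ≤ Real.sqrt (deriv f a) * Real.sqrt (deriv f b) := by positivity
  have hS : 0 ≤ ∑ k ∈ Finset.Icc 2 n, D ^ k * |h k a b| :=
    Finset.sum_nonneg fun k _ => by positivity
  have hDU := mul_nonneg hD hU
  have hCD : 0 ≤ C * D ^ (n + 1) := by positivity
  rcases hcase with ⟨h1, h2⟩ | hI
  · rw [hx0 h1, hy0 h2]
    have := mul_nonneg hCD hI0
    rw [sub_zero, abs_zero]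
    linarith
  · have e1 : |(a - b) * (Real.sqrt (deriv f a) * Real.sqrt (deriv f b))|
        ≤ D * (Real.sqrt (deriv f a) * Real.sqrt (deriv f b)) := by
      rw [abs_mul, abs_of_nonneg hU]
      gcongr
    have e2 : |∑ k ∈ Finset.Icc 2 n, (a - b) ^ k * h k a b|
        ≤ ∑ k ∈ Finset.Icc 2 n, D ^ k * |h k a b| := by
      refine (Finset.abs_sum_le_sum_abs _ _).trans (Finset.sum_le_sum fun k _ => ?_)
      rw [abs_mul, abs_pow]
      gcongr
    have e3 : |Rn a b * (a - b) ^ (n + 1)| ≤ C * D ^ (n + 1) := by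
      rw [abs_mul, abs_pow]
      gcongr
    have e4 := le_mul_of_one_le_right hCD hI
    rw [hE]
    refine (abs_add_three _ _ _).trans ?_
    linarith
end
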